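/- Under the standing hypotheses, no cycle of length g in G and cycle of length g+1 in G share three consecutive edges; that is, there do not exist a g-cycle C and a (g+1)-cycle D in G together with a path ⟨a, b, c, d⟩ all three of whose edges belong to both C and D. -/

import Mathlib

open SimpleGraph

/-- Two graphs have the same `k`-deck if there is a bijection between their `k`-element
vertex subsets under which corresponding induced subgraphs are isomorphic. -/
def SameDeck {V W : Type*} [Fintype V] [Fintype W] [DecidableEq V] [DecidableEq W]
    (G : SimpleGraph V) (H : SimpleGraph W) (k : ℕ) : Prop :=
  ∃ e : {s : Finset V // s.card = k} ≃ {s : Finset W // s.card = k},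
    ∀ s : {s : Finset V // s.card = k},
      Nonempty ((G.induce (↑s.1 : Set V)) ≃g (H.induce (↑(e s).1 : Set W)))

section Cycles

variable {V W : Type*} {G : SimpleGraph V} {H : SimpleGraph W}

/-- A cycle traversing the consecutive edges `ab`, `bc`, `cd` can be parametrized by a periodic
sequence of vertices starting with `a, b, c, d`. -/
lemma exists_periodic_of_isCycle {v a b c d : V} {C : G.Walk v v}
    (hC : C.IsCycle) (hac : a ≠ c) (hbd : b ≠ d) (hab : s(a, b) ∈ C.edges)
    (hbc : s(b, c) ∈ C.edges) (hcd : s(c, d) ∈ C.edges) :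
    ∃ f : ℕ → V, (∀ i, G.Adj (f i) (f (i + 1))) ∧ (∀ i j, f i = f j ↔ i ≡ j [MOD C.length]) ∧
      f 0 = a ∧ f 1 = b ∧ f 2 = c ∧ f 3 = d := by
  classical
  obtain ⟨D, hD, hlen, hb, hbc, hcd⟩ : ∃ D : G.Walk a a, D.IsCycle ∧ D.length = C.length ∧
      D.getVert 1 = b ∧ s(b, c) ∈ D.edges ∧ s(c, d) ∈ D.edges := by
    have ha : a ∈ C.support := C.fst_mem_support_of_mem_edges hab
    have hperm := (C.rotate_edges a ha).perm
    have hR := hC.rotate ha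
    have hlen : (C.rotate a ha).length = C.length := by
      simp
    rw [← hperm.mem_iff] at hab hbc hcd
    generalize C.rotate a ha = R at *
    have hb : b ∈ R.toSubgraph.neighborSet a := Walk.adj_toSubgraph_iff_mem_edges.2 hab
    rw [hR.neighborSet_toSubgraph_endpoint] at hb
    rcases hb with hb | hb
    · exact ⟨R, hR, hlen, hb.symm, hbc, hcd⟩
    · refine ⟨R.reverse, hR.reverse, by simpa using hlen, ?_, by simpa using hbc,
        by simpa using hcd⟩
      rw [Walk.getVert_reverse]
      exact hb.symm
  rw [← hlen]
  have h3 := hD.three_le_length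
  have key : ∀ {i : ℕ} {u w : V}, i + 1 < D.length → D.getVert i = u → u ≠ w →
      s(D.getVert (i + 1), w) ∈ D.edges → D.getVert (i + 2) = w := by
    intro i u w hi hu huw hw
    have hw' : w ∈ D.toSubgraph.neighborSet (D.getVert (i + 1)) :=
      Walk.adj_toSubgraph_iff_mem_edges.2 hw
    rw [hD.neighborSet_toSubgraph_internal (by lia) hi] at hw'
    rcases hw' with hw' | hw'
    · simp only [Nat.add_sub_cancel] at hw'
      exact absurd (hu.symm.trans hw'.symm) huw
    · exact hw'.symm
  have hc : D.getVert 2 = c := key (i := 0) (by lia) D.getVert_zero hac (by simpa [hb] using hbc)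
  have hd : D.getVert 3 = d := key (i := 1) (by lia) hb hbd (by simpa [hc] using hcd)
  have hmod : ∀ i, i ≤ D.length → D.getVert (i % D.length) = D.getVert i := by
    intro i hi
    rcases hi.lt_or_eq with hi | rfl
    · rw [Nat.mod_eq_of_lt hi]
    · simp
  refine ⟨fun i ↦ D.getVert (i % D.length), fun i ↦ ?_, fun i j ↦ ?_, ?_, ?_, ?_, ?_⟩
  · have hi : i % D.length < D.length := Nat.mod_lt _ (by lia)
    have h := D.adj_getVert_succ hi
    rwa [← hmod (i % D.length + 1) hi, Nat.mod_add_mod] at h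
  · refine ⟨fun h ↦ ?_, fun h ↦ congrArg D.getVert h⟩
    have hi : i % D.length < D.length := Nat.mod_lt _ (by lia)
    have hj : j % D.length < D.length := Nat.mod_lt _ (by lia)
    exact hD.getVert_injOn' (by simp only [Set.mem_ofPred_eq]; lia)
      (by simp only [Set.mem_ofPred_eq]; lia) h
  · simp
  · exact (hmod 1 (by lia)).trans hb
  · exact (hmod 2 (by lia)).trans hc
  · exact (hmod 3 (by lia)).trans hd

lemma exists_isPath_of_injOn (f : ℕ → V) (l : ℕ) (hadj : ∀ i < l, G.Adj (f i) (f (i + 1)))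
    (hinj : Set.InjOn f (Set.Iic l)) :
    ∃ p : G.Walk (f 0) (f l), p.IsPath ∧ p.length = l ∧ ∀ v ∈ p.support, ∃ i ≤ l, f i = v := by
  induction l with
  | zero => exact ⟨.nil, by simp, rfl, by simp⟩
  | succ l ih =>
    obtain ⟨p, hp, hl, hs⟩ := ih (fun i hi ↦ hadj i (by lia))
      (hinj.mono (Set.Iic_subset_Iic.2 (by lia)))
    refine ⟨p.concat (hadj l (by lia)), hp.concat ?_ _, by simp [hl], fun v hv ↦ ?_⟩
    · intro h
      obtain ⟨i, hi, he⟩ := hs _ h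
      have := hinj (Set.mem_Iic.2 (by lia)) (Set.mem_Iic.2 le_rfl) he
      lia
    · rw [Walk.support_concat, List.mem_append, List.mem_singleton] at hv
      rcases hv with hv | rfl
      · obtain ⟨i, hi, he⟩ := hs _ hv
        exact ⟨i, by lia, he⟩
      · exact ⟨l + 1, le_rfl, rfl⟩

lemma exists_isCycle_of_isPath {u v x : V} {p : G.Walk u v} (hp : p.IsPath) (huv : u ≠ v)
    (hx : x ∉ p.support) (hu : G.Adj x u) (hv : G.Adj v x) :
    ∃ c : G.Walk x x, c.IsCycle ∧ c.length = p.length + 2 := by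
  refine ⟨.cons hu (p.concat hv), (Walk.cons_isCycle_iff _ _).2 ⟨hp.concat hx hv, fun h ↦ ?_⟩,
    by simp⟩
  rw [Walk.edges_concat, List.concat_eq_append, List.mem_append, List.mem_singleton] at h
  rcases h with h | h
  · exact hx (p.fst_mem_support_of_mem_edges h)
  · have := hu.ne
    grind

lemma length_induce {s : Set V} {u v : V} (p : G.Walk u v) (hp : ∀ w ∈ p.support, w ∈ s) :
    (p.induce s hp).length = p.length := by
  induction p with
  | nil => rfl
  | cons h p ih => simp [ih]

lemma exists_isCycle_of_triangle {u v w : V} (huv : G.Adj u v) (hvw : G.Adj v w)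
    (hwu : G.Adj w u) : ∃ c : G.Walk w w, c.IsCycle ∧ c.length = 3 :=
  exists_isCycle_of_isPath (p := .cons huv .nil) (by simpa using huv.ne) huv.ne
    (by simpa using ⟨hwu.ne, hvw.ne'⟩) hwu hvw

/-- If `f` runs through a path of length `l` inside `s`, and `x ∉ t` is adjacent to the images of
both ends under an isomorphism `G[s] ≃ H[t]`, then `H` has a cycle of length `l + 2`. -/
lemma exists_isCycle_of_induce_iso {s : Set V} {t : Set W} (φ : G.induce s ≃g H.induce t)
    (f : ℕ → V) {l : ℕ} (hl : 0 < l) (hadj : ∀ i < l, G.Adj (f i) (f (i + 1)))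
    (hinj : Set.InjOn f (Set.Iic l)) (hs : ∀ i ≤ l, f i ∈ s) {x : W} (hx : x ∉ t)
    (h0 : H.Adj x (φ ⟨f 0, hs 0 (Nat.zero_le l)⟩)) (h1 : H.Adj x (φ ⟨f l, hs l le_rfl⟩)) :
    ∃ (w : W) (c : H.Walk w w), c.IsCycle ∧ c.length = l + 2 := by
  obtain ⟨p, hp, hlen, hsupp⟩ := exists_isPath_of_injOn f l hadj hinj
  have hps : ∀ v ∈ p.support, v ∈ s := fun v hv ↦ by
    obtain ⟨i, hi, rfl⟩ := hsupp v hv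
    exact hs i hi
  have hq : (p.induce s hps).IsPath :=
    Walk.IsPath.of_map (f := (Embedding.induce s).toHom) (by rwa [Walk.map_induce])
  have hq' := (hq.map (f := φ.toHom) φ.injective).map
    (f := (Embedding.induce (G := H) t).toHom) Subtype.val_injective
  have hne : f 0 ≠ f l := fun h ↦ by
    have := hinj (Set.mem_Iic.2 (Nat.zero_le l)) (Set.mem_Iic.2 le_rfl) h
    lia
  have hxq : x ∉ (((p.induce s hps).map φ.toHom).map
      (Embedding.induce (G := H) t).toHom).support := by
    rw [Walk.support_map, List.mem_map]
    rintro ⟨y, -, rfl⟩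
    exact hx y.2
  obtain ⟨c, hc, hclen⟩ := exists_isCycle_of_isPath hq'
    (fun h ↦ hne (congrArg Subtype.val (φ.injective (Subtype.val_injective h)))) hxq h0 h1.symm
  exact ⟨x, c, hc, by rw [hclen, Walk.length_map, Walk.length_map, length_induce, hlen]⟩

end Cycles

section Decks

variable {V W : Type*} [Fintype V] [Fintype W] [DecidableEq V] [DecidableEq W]
  {G : SimpleGraph V} {H : SimpleGraph W}

lemma SameDeck.exists_isCycle {k : ℕ} (h : SameDeck G H k) (hk : k ≤ Fintype.card W) {w : W}
    {c : H.Walk w w} (hc : c.IsCycle) (hlen : c.length ≤ k) :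
    ∃ (v : V) (d : G.Walk v v), d.IsCycle ∧ d.length = c.length := by
  obtain ⟨e, he⟩ := h
  have hcard : c.support.toFinset.card ≤ k := by
    refine le_trans ?_ hlen
    have hsub : c.support.toFinset ⊆ c.support.tail.toFinset := by
      intro v hv
      rw [List.mem_toFinset] at hv ⊢
      rcases (Walk.mem_support_iff c).1 hv with rfl | hv
      · exact Walk.end_mem_tail_support hc.not_nil
      · exact hv
    refine (Finset.card_le_card hsub).trans ((List.toFinset_card_le _).trans ?_)
    simp
  obtain ⟨t, hct, ht⟩ := Finset.exists_superset_card_eq hcard hk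
  obtain ⟨s, hs⟩ := e.surjective ⟨t, ht⟩
  obtain ⟨φ⟩ := he s
  rw [hs] at φ
  have hsupp : ∀ v ∈ c.support, v ∈ (t : Set W) := fun v hv ↦ hct (List.mem_toFinset.2 hv)
  have hd : (c.induce _ hsupp).IsCycle :=
    Walk.IsCycle.of_map (f := (Embedding.induce _).toHom) (by rwa [Walk.map_induce])
  refine ⟨_, _, (hd.map (f := φ.symm.toHom) φ.symm.injective).map
    (f := (Embedding.induce (G := G) _).toHom) Subtype.val_injective, ?_⟩
  rw [Walk.length_map, Walk.length_map, length_induce]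

lemma card_filter_pair {α : Type*} [DecidableEq α] {a b : α} (hab : a ≠ b) (P : α → Prop)
    [DecidablePred P] : (({a, b} : Finset α).filter P).card =
      (if P a then 1 else 0) + (if P b then 1 else 0) := by
  rw [Finset.card_filter, Finset.sum_pair hab]

lemma card_filter_compl_eq [DecidableRel G.Adj] [DecidableRel H.Adj] {r : ℕ}
    (hG : G.IsRegularOfDegree r) (hH : H.IsRegularOfDegree r) {s : Finset V} {t : Finset W}
    (φ : G.induce (s : Set V) ≃g H.induce (t : Set W)) (v : (s : Set V)) :
    (sᶜ.filter (G.Adj v)).card = (tᶜ.filter (H.Adj (φ v))).card := by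
  have hs : (s.filter (G.Adj v)).card + (sᶜ.filter (G.Adj v)).card = r := by
    rw [← hG v, ← G.card_neighborFinset_eq_degree, G.neighborFinset_eq_filter,
      ← Finset.card_union_of_disjoint (Finset.disjoint_filter_filter disjoint_compl_right),
      ← Finset.filter_union, Finset.union_compl]
  have ht : (t.filter (H.Adj (φ v))).card + (tᶜ.filter (H.Adj (φ v))).card = r := by
    rw [← hH (φ v), ← H.card_neighborFinset_eq_degree, H.neighborFinset_eq_filter,
      ← Finset.card_union_of_disjoint (Finset.disjoint_filter_filter disjoint_compl_right),
      ← Finset.filter_union, Finset.union_compl]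
  have hst : (s.filter (G.Adj v)).card = (t.filter (H.Adj (φ v))).card := by
    refine Finset.card_bij (fun u hu ↦ (φ ⟨u, (Finset.mem_filter.1 hu).1⟩ : W)) ?_ ?_ ?_
    · intro u hu
      rw [Finset.mem_filter] at hu ⊢
      refine ⟨(φ ⟨u, hu.1⟩).2, ?_⟩
      have : (G.induce (s : Set V)).Adj v ⟨u, hu.1⟩ := hu.2
      exact φ.map_rel_iff.2 this
    · intro u hu u' hu' h
      exact congrArg Subtype.val (φ.injective (Subtype.val_injective h))
    · intro w hw
      rw [Finset.mem_filter] at hw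
      obtain ⟨u, hu⟩ := φ.surjective ⟨w, hw.1⟩
      have h : (H.induce (t : Set W)).Adj (φ v) (φ u) := by
        rw [hu]
        exact hw.2
      exact ⟨u, Finset.mem_filter.2 ⟨u.2, φ.map_rel_iff.1 h⟩, by simp [hu]⟩
  lia

/-- An isomorphism between cards missing two vertices extends to the whole graphs as soon as it
respects the adjacencies with the missing vertices. -/
lemma nonempty_iso_of_induce_iso (hcard : Fintype.card V = Fintype.card W) {s : Finset V}
    {t : Finset W} (φ : G.induce (s : Set V) ≃g H.induce (t : Set W)) {p q : V} {x y : W}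
    (hs : sᶜ = {p, q}) (ht : tᶜ = {x, y}) (hxy : x ≠ y) (hpq : ¬ G.Adj p q) (hxy' : ¬ H.Adj x y)
    (hp : ∀ v : (s : Set V), G.Adj v p ↔ H.Adj (φ v) x)
    (hq : ∀ v : (s : Set V), G.Adj v q ↔ H.Adj (φ v) y) :
    Nonempty (G ≃g H) := by
  classical
  have hmem : ∀ v, v ∉ s ↔ v = p ∨ v = q := fun v ↦ by rw [← Finset.mem_compl, hs]; simp
  have hmem' : ∀ w, w ∉ t ↔ w = x ∨ w = y := fun v ↦ by rw [← Finset.mem_compl, ht]; simp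
  let ψ : V → W := fun v ↦ if h : v ∈ s then φ ⟨v, h⟩ else if v = p then x else y
  have hψ : ∀ v (h : v ∈ s), ψ v = φ ⟨v, h⟩ := fun v h ↦ by simp [ψ, h]
  have hψp : ψ p = x := by simp [ψ, (hmem p).2 (.inl rfl)]
  have hψq : q ≠ p → ψ q = y := fun h ↦ by simp [ψ, (hmem q).2 (.inr rfl), h]
  have hψt : ∀ v, v ∈ s → ψ v ∈ t := fun v h ↦ by
    rw [hψ v h]
    exact (φ ⟨v, h⟩).2
  have hxt := (hmem' x).2 (.inl rfl)
  have hyt := (hmem' y).2 (.inr rfl)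
  have hinj : Function.Injective ψ := by
    intro u v huv
    by_cases hu : u ∈ s <;> by_cases hv : v ∈ s
    · rw [hψ u hu, hψ v hv] at huv
      exact congrArg Subtype.val (φ.injective (Subtype.val_injective huv))
    · have := hψt u hu
      grind
    · have := hψt v hv
      grind
    · grind
  have hbij := (Fintype.bijective_iff_injective_and_card ψ).2 ⟨hinj, hcard⟩
  have hadj_s : ∀ u ∈ s, ∀ v, G.Adj u v ↔ H.Adj (ψ u) (ψ v) := by
    intro u hu v
    by_cases hv : v ∈ s
    · rw [hψ u hu, hψ v hv]
      exact (φ.map_rel_iff (a := ⟨u, hu⟩) (b := ⟨v, hv⟩)).symm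
    · have h1 := hp ⟨u, hu⟩
      have h2 := hq ⟨u, hu⟩
      rw [hψ u hu]
      grind
  refine ⟨⟨Equiv.ofBijective ψ hbij, fun {u v} ↦ ?_⟩⟩
  simp only [Equiv.ofBijective_apply]
  by_cases hu : u ∈ s
  · exact (hadj_s u hu v).symm
  by_cases hv : v ∈ s
  · rw [H.adj_comm, G.adj_comm]
    exact (hadj_s v hv u).symm
  have h1 := G.adj_comm p q
  have h2 := H.adj_comm x y
  have h3 := fun v ↦ G.loopless.irrefl v
  have h4 := fun v ↦ H.loopless.irrefl v
  grind

/-- If a `g`-cycle `c` and a `(g + 1)`-cycle `d`, given as periodic sequences, agree on four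
consecutive vertices, then they agree on the next one. -/
lemma eq_next_of_eq [DecidableRel G.Adj] [DecidableRel H.Adj]
    (hG : G.IsRegularOfDegree 3) (hH : H.IsRegularOfDegree 3)
    (hcard : Fintype.card V = Fintype.card W) (hdeck : SameDeck G H (Fintype.card V - 2))
    (hniso : ¬ Nonempty (G ≃g H)) {g : ℕ} (hg : 5 ≤ g)
    (hgG : ∀ (v : V) (w : G.Walk v v), w.IsCycle → g ≤ w.length)
    (hgH : ∀ (v : W) (w : H.Walk v v), w.IsCycle → g ≤ w.length)
    {c d : ℕ → V} (hc : ∀ i, G.Adj (c i) (c (i + 1))) (hd : ∀ i, G.Adj (d i) (d (i + 1)))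
    (hcinj : ∀ i j, c i = c j ↔ i ≡ j [MOD g]) (hdinj : ∀ i j, d i = d j ↔ i ≡ j [MOD g + 1])
    (m : ℕ) (h0 : c m = d m) (h1 : c (m + 1) = d (m + 1)) (h2 : c (m + 2) = d (m + 2))
    (h3 : c (m + 3) = d (m + 3)) : c (m + 4) = d (m + 4) := by
  by_contra hne
  have hcne : ∀ i j, i < j → j < i + g → c i ≠ c j := fun i j hij hj h ↦ by
    have := (Nat.modEq_iff_dvd' hij.le).1 ((hcinj i j).1 h)
    have := Nat.le_of_dvd (by lia) this
    lia
  have hdne : ∀ i j, i < j → j < i + (g + 1) → d i ≠ d j := fun i j hij hj h ↦ by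
    have := (Nat.modEq_iff_dvd' hij.le).1 ((hdinj i j).1 h)
    have := Nat.le_of_dvd (by lia) this
    lia
  have hcg : c (m + g) = c m := (hcinj _ _).2 (by simp [Nat.ModEq])
  have hdg : d (m + (g + 1)) = d m := (hdinj _ _).2 (by simp [Nat.ModEq])
  set s : Finset V := {c (m + 1), c (m + 3)}ᶜ with hs
  have hsc : sᶜ = {c (m + 1), c (m + 3)} := by simp [hs]
  have hpq : c (m + 1) ≠ c (m + 3) := hcne _ _ (by lia) (by lia)
  have hscard : s.card = Fintype.card V - 2 := by
    rw [hs, Finset.card_compl, Finset.card_pair hpq]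
  have hV : 2 ≤ Fintype.card V := by
    rw [← Finset.card_pair hpq]
    exact Finset.card_le_univ _
  obtain ⟨e, he⟩ := hdeck
  obtain ⟨φ⟩ := he ⟨s, hscard⟩
  have htcard := (e ⟨s, hscard⟩).2
  generalize (e ⟨s, hscard⟩).1 = t at φ htcard
  have htc : tᶜ.card = 2 := by
    rw [Finset.card_compl, htcard]
    lia
  obtain ⟨x, y, hxy, ht⟩ : ∃ x y, x ≠ y ∧ tᶜ = {x, y} := Finset.card_eq_two.1 htc
  have hmem : ∀ v, v ∈ (s : Set V) ↔ v ≠ c (m + 1) ∧ v ≠ c (m + 3) := fun v ↦ by simp [hs, and_comm]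
  have hcs : ∀ i ≤ g - 4, c (m + 4 + i) ∈ (s : Set V) := fun i hi ↦
    (hmem _).2 ⟨(hcne _ _ (by lia) (by lia)).symm, (hcne _ _ (by lia) (by lia)).symm⟩
  have hds : ∀ i ≤ g - 3, d (m + 4 + i) ∈ (s : Set V) := fun i hi ↦ by
    rw [hmem, h1, h3]
    exact ⟨(hdne _ _ (by lia) (by lia)).symm, (hdne _ _ (by lia) (by lia)).symm⟩
  have h0s : c m ∈ (s : Set V) :=
    (hmem _).2 ⟨hcne _ _ (by lia) (by lia), hcne _ _ (by lia) (by lia)⟩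
  have h2s : c (m + 2) ∈ (s : Set V) :=
    (hmem _).2 ⟨(hcne _ _ (by lia) (by lia)).symm, hcne _ _ (by lia) (by lia)⟩
  have h4s : c (m + 4) ∈ (s : Set V) := hcs 0 (by lia)
  have h4s' : d (m + 4) ∈ (s : Set V) := hds 0 (by lia)
  have hcount : ∀ v : (s : Set V),
      (if G.Adj v (c (m + 1)) then 1 else 0) + (if G.Adj v (c (m + 3)) then 1 else 0) =
        (if H.Adj (φ v) x then 1 else 0) + (if H.Adj (φ v) y then 1 else 0) := fun v ↦ by
    rw [← card_filter_pair hpq, ← card_filter_pair hxy, ← ht, ← hsc]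
    exact card_filter_compl_eq hG hH φ v
  wlog hx0 : H.Adj (φ ⟨c m, h0s⟩) x generalizing x y
  · have h := hcount ⟨c m, h0s⟩
    refine this y x hxy.symm (by rw [ht, Finset.pair_comm])
      (fun v ↦ (hcount v).trans (add_comm _ _)) ?_
    by_contra hy
    simp [hx0, hy, hc m] at h
  have hxt : x ∉ (t : Set W) := by
    have : x ∈ tᶜ := by simp [ht]
    simpa using this
  have hcx : ¬ H.Adj x (φ ⟨c (m + 4), h4s⟩) := by
    intro h
    have hlast : c (m + 4 + (g - 4)) = c m := by
      rw [← hcg]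
      congr 1
      lia
    obtain ⟨w, z, hz, hzl⟩ := exists_isCycle_of_induce_iso φ (fun i ↦ c (m + 4 + i)) (l := g - 4)
      (by lia) (fun i _ ↦ hc _) (fun i hi j hj hij ↦ by
        by_contra hij'
        rw [Set.mem_Iic] at hi hj
        rcases Nat.lt_or_gt_of_ne hij' with h | h
        · exact hcne _ _ (by lia) (by lia) hij
        · exact hcne _ _ (by lia) (by lia) hij.symm) hcs hxt h
        (by simpa only [hlast] using hx0.symm)
    have := hgH w z hz
    lia
  have hdx : ¬ H.Adj x (φ ⟨d (m + 4), h4s'⟩) := by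
    intro h
    have hlast : d (m + 4 + (g - 3)) = c m := by
      rw [h0, ← hdg]
      congr 1
      lia
    obtain ⟨w, z, hz, hzl⟩ := exists_isCycle_of_induce_iso φ (fun i ↦ d (m + 4 + i)) (l := g - 3)
      (by lia) (fun i _ ↦ hd _) (fun i hi j hj hij ↦ by
        by_contra hij'
        rw [Set.mem_Iic] at hi hj
        rcases Nat.lt_or_gt_of_ne hij' with h | h
        · exact hdne _ _ (by lia) (by lia) hij
        · exact hdne _ _ (by lia) (by lia) hij.symm) hds hxt h
        (by simpa only [hlast] using hx0.symm)
    have := hgH w z hz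
    lia
  have hcd : G.Adj (c (m + 3)) (d (m + 4)) := h3 ▸ hd (m + 3)
  have hcy : H.Adj y (φ ⟨c (m + 4), h4s⟩) := by
    have h := hcount ⟨c (m + 4), h4s⟩
    rw [H.adj_comm] at hcx ⊢
    by_contra hy
    simp [hcx, hy, (hc (m + 3)).symm] at h
  have hdy : H.Adj y (φ ⟨d (m + 4), h4s'⟩) := by
    have h := hcount ⟨d (m + 4), h4s'⟩
    rw [H.adj_comm] at hdx ⊢
    by_contra hy
    simp [hdx, hy, hcd.symm] at h
  have h2y : H.Adj y (φ ⟨c (m + 2), h2s⟩) := by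
    have h := hcount ⟨c (m + 2), h2s⟩
    rw [H.adj_comm]
    by_contra hy
    rw [if_pos (hc (m + 1)).symm, if_pos (hc (m + 2)), if_neg hy] at h
    split_ifs at h <;> lia
  have h24 : c (m + 2) ≠ c (m + 4) := hcne _ _ (by lia) (by lia)
  have h24' : c (m + 2) ≠ d (m + 4) := h2 ▸ hdne _ _ (by lia) (by lia)
  have hNq : G.neighborFinset (c (m + 3)) = {c (m + 2), c (m + 4), d (m + 4)} := by
    symm
    apply Finset.eq_of_subset_of_card_le
    · intro v hv
      rw [mem_neighborFinset]
      simp only [Finset.mem_insert, Finset.mem_singleton] at hv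
      rcases hv with rfl | rfl | rfl
      exacts [(hc _).symm, hc _, hcd]
    · rw [G.card_neighborFinset_eq_degree, hG,
        Finset.card_eq_three.2 ⟨_, _, _, h24, h24', hne, rfl⟩]
  have hφne : ∀ u v : (s : Set V), (u : V) ≠ v → (φ u : W) ≠ φ v := fun u v h h' ↦
    h (congrArg Subtype.val (φ.injective (Subtype.val_injective h')))
  have hNy : H.neighborFinset y =
      {(φ ⟨c (m + 2), h2s⟩ : W), (φ ⟨c (m + 4), h4s⟩ : W), (φ ⟨d (m + 4), h4s'⟩ : W)} := by
    symm
    apply Finset.eq_of_subset_of_card_le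
    · intro v hv
      rw [mem_neighborFinset]
      simp only [Finset.mem_insert, Finset.mem_singleton] at hv
      rcases hv with rfl | rfl | rfl
      exacts [h2y, hcy, hdy]
    · rw [H.card_neighborFinset_eq_degree, hH, Finset.card_eq_three.2 ⟨_, _, _,
        hφne _ _ h24, hφne _ _ h24', hφne _ _ hne, rfl⟩]
  have hq : ∀ v : (s : Set V), G.Adj v (c (m + 3)) ↔ H.Adj (φ v) y := fun v ↦ by
    rw [G.adj_comm, H.adj_comm, ← mem_neighborFinset, ← mem_neighborFinset, hNq, hNy]
    simp only [Finset.mem_insert, Finset.mem_singleton, Subtype.val_inj, φ.injective.eq_iff,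
      Subtype.ext_iff]
  have hp : ∀ v : (s : Set V), G.Adj v (c (m + 1)) ↔ H.Adj (φ v) x := fun v ↦ by
    have h := hcount v
    simp only [hq v, Nat.add_right_cancel_iff] at h
    by_cases h1 : G.Adj v (c (m + 1)) <;> by_cases h2 : H.Adj (φ v) x <;> simp [h1, h2] at h ⊢
  have hpq' : ¬ G.Adj (c (m + 1)) (c (m + 3)) := by
    intro h
    obtain ⟨z, hz, hzl⟩ := exists_isCycle_of_triangle (hc (m + 1)) (hc (m + 2)) h.symm
    have := hgG _ z hz
    lia
  have hxy' : ¬ H.Adj x y := by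
    intro h
    rw [H.adj_comm, ← mem_neighborFinset, hNy] at h
    simp only [Finset.mem_insert, Finset.mem_singleton] at h
    rcases h with h | h | h <;> exact hxt (h ▸ Subtype.coe_prop _)
  exact hniso (nonempty_iso_of_induce_iso hcard φ hsc ht hxy hpq' hxy' hp hq)

end Decks

/-- Standing hypotheses: `G` and `H` are 3-regular graphs on the same number `n` of vertices
with the same `(n-2)`-deck, `H` is not isomorphic to `G`, and `g` is the girth of `G`. -/
theorem no_three_consecutive_shared_edges
    {V W : Type*} [Fintype V] [Fintype W] [DecidableEq V] [DecidableEq W]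
    (G : SimpleGraph V) (H : SimpleGraph W)
    [DecidableRel G.Adj] [DecidableRel H.Adj]
    (hG : G.IsRegularOfDegree 3) (hH : H.IsRegularOfDegree 3)
    (hcard : Fintype.card V = Fintype.card W)
    (hdeck : SameDeck G H (Fintype.card V - 2))
    (hniso : ¬ Nonempty (G ≃g H))
    (g : ℕ) (hgirth : G.egirth = g)
    :
    ¬ ∃ (v₁ v₂ : V) (C : G.Walk v₁ v₁) (D : G.Walk v₂ v₂) (a b c d : V),
      C.IsCycle ∧ D.IsCycle ∧ C.length = g ∧ D.length = g + 1 ∧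
      ([a, b, c, d] : List V).Nodup ∧
      s(a, b) ∈ C.edges ∧ s(b, c) ∈ C.edges ∧ s(c, d) ∈ C.edges ∧
      s(a, b) ∈ D.edges ∧ s(b, c) ∈ D.edges ∧ s(c, d) ∈ D.edges := by
  rintro ⟨v₁, v₂, C, D, p, q, r, u, hC, hD, rfl, hDl, hnd, h1, h2, h3, h4, h5, h6⟩
  have hpr : p ≠ r := by grind
  have hqu : q ≠ u := by grind
  have hpu : p ≠ u := by grind
  obtain ⟨c, hc, hcinj, hc0, hc1, hc2, hc3⟩ := exists_periodic_of_isCycle hC hpr hqu h1 h2 h3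
  obtain ⟨d, hd, hdinj, hd0, hd1, hd2, hd3⟩ := exists_periodic_of_isCycle hD hpr hqu h4 h5 h6
  rw [hDl] at hdinj
  have hg := hC.three_le_length
  generalize C.length = g at *
  have hgG : ∀ (v : V) (w : G.Walk v v), w.IsCycle → g ≤ w.length := fun v w hw ↦ by
    have := egirth_le_length hw
    rw [hgirth] at this
    exact_mod_cast this
  have hg3 : g ≠ 3 := by
    rintro rfl
    exact hpu (by rw [← hc0, ← hc3, hcinj]; rfl)
  have hg4 : g ≠ 4 := by
    rintro rfl
    have h03 : c 0 = c 4 := (hcinj _ _).2 rfl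
    have h05 : d 0 = d 5 := (hdinj _ _).2 rfl
    have hup : G.Adj u p := by
      rw [← hc0, h03, ← hc3]
      exact hc 3
    have h34 : G.Adj u (d 4) := hd3 ▸ hd 3
    have h45 : G.Adj (d 4) p := by
      rw [← hd0, h05]
      exact hd 4
    obtain ⟨z, hz, hzl⟩ := exists_isCycle_of_triangle h34 h45 hup.symm
    have := hgG _ z hz
    lia
  have hgV : g + 1 ≤ Fintype.card V := by
    have hinj : Function.Injective (fun i : Fin (g + 1) ↦ d i) := fun i j hij ↦
      Fin.ext (((hdinj _ _).1 hij).eq_of_lt_of_lt i.2 j.2)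
    simpa using Fintype.card_le_of_injective _ hinj
  have hgH : ∀ (v : W) (w : H.Walk v v), w.IsCycle → g ≤ w.length := fun v w hw ↦ by
    by_contra! hlt
    obtain ⟨v', w', hw', hl⟩ := hdeck.exists_isCycle (by lia) hw (by lia)
    have := hgG v' w' hw'
    lia
  have key : ∀ m, c m = d m ∧ c (m + 1) = d (m + 1) ∧ c (m + 2) = d (m + 2) ∧
      c (m + 3) = d (m + 3) := by
    intro m
    induction m with
    | zero => simp [hc0, hc1, hc2, hc3, hd0, hd1, hd2, hd3]
    | succ m ih =>
      obtain ⟨e0, e1, e2, e3⟩ := ih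
      exact ⟨e1, e2, e3, eq_next_of_eq hG hH hcard hdeck hniso (by lia) hgG hgH hc hd hcinj hdinj
        m e0 e1 e2 e3⟩
  have hcg : c g = c 0 := (hcinj _ _).2 (by simp [Nat.ModEq])
  have hdg : d g = d 0 := by rw [← (key g).1, ← (key 0).1, hcg]
  have := Nat.le_of_dvd (by lia) ((Nat.modEq_zero_iff_dvd).1 ((hdinj _ _).1 hdg))
  lia
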